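/- Under the stated assumptions, Φ is differentiable at every x ∈ E and its gradient (the hypergradient) equals ∇Φ(x) = ∇_x f(x, y*(x)) − ∇²_{xy} g(x, y*(x)) [ (∇²_{yy} g(x, y*(x)))⁻¹ ∇_y f(x, y*(x)) ], where ∇²_{yy} g(x,y) : F → F is the partial Hessian in y (invertible since it is ≥ μ·Id) and ∇²_{xy} g(x,y) : F → E is the mixed second partial derivative. -/

import Mathlib

open Real Set

noncomputable section

variable {E F : Type*}
  [NormedAddCommGroup E] [InnerProductSpace ℝ E] [FiniteDimensional ℝ E]
  [NormedAddCommGroup F] [InnerProductSpace ℝ F] [FiniteDimensional ℝ F]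

/-- The point `(x, y)` of the `ℓ²` product `WithLp 2 (E × F)`. -/
abbrev pmk (x : E) (y : F) : WithLp 2 (E × F) :=
  (WithLp.equiv 2 (E × F)).symm (x, y)

/-- The partial gradient `∇_x f(x, y) ∈ E`. -/
def gradx (f : WithLp 2 (E × F) → ℝ) (x : E) (y : F) : E :=
  ((WithLp.equiv 2 (E × F)) (gradient f (pmk x y))).1

/-- The partial gradient `∇_y f(x, y) ∈ F`. -/
def grady (f : WithLp 2 (E × F) → ℝ) (x : E) (y : F) : F :=
  ((WithLp.equiv 2 (E × F)) (gradient f (pmk x y))).2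

/-- The partial Hessian `∇²_{yy} g(x, y) : F → F`. -/
def hessyy (g : WithLp 2 (E × F) → ℝ) (x : E) (y : F) : F →L[ℝ] F :=
  fderiv ℝ (fun y' : F => grady g x y') y

/-- The mixed second partial derivative `∇²_{xy} g(x, y) : F → E`. -/
def hessxy (g : WithLp 2 (E × F) → ℝ) (x : E) (y : F) : F →L[ℝ] E :=
  fderiv ℝ (fun y' : F => gradx g x y') y

/-- The linear isomorphism underlying `pmk`. -/
abbrev pmkL : (E × F) ≃L[ℝ] WithLp 2 (E × F) :=
  (WithLp.prodContinuousLinearEquiv 2 ℝ E F).symm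

lemma inner_pmk (w : WithLp 2 (E × F)) (u : E) (v : F) :
    inner ℝ w (pmk u v) = inner ℝ (pmkL.symm w).1 u + inner ℝ (pmkL.symm w).2 v :=
  WithLp.prod_inner_apply w (pmk u v)

lemma contDiff_gradient {H : Type*} [NormedAddCommGroup H] [InnerProductSpace ℝ H]
    [CompleteSpace H] {g : H → ℝ} (hg : ContDiff ℝ 2 g) : ContDiff ℝ 1 (gradient g) :=
  (InnerProductSpace.toDual ℝ H).symm.contDiff.comp
    (hg.fderiv_right (by norm_num [one_add_one_eq_two]))

/-- The Hessian of a `C²` function is symmetric. -/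
lemma inner_fderiv_gradient_comm {H : Type*} [NormedAddCommGroup H]
    [InnerProductSpace ℝ H] [CompleteSpace H] {g : H → ℝ} (hg : ContDiff ℝ 2 g) (p u w : H) :
    inner ℝ (fderiv ℝ (gradient g) p u) w =
      inner ℝ (fderiv ℝ (gradient g) p w) u := by
  have hG : DifferentiableAt ℝ (gradient g) p := (contDiff_gradient hg).differentiable one_ne_zero p
  have h : ∀ a b, fderiv ℝ (fderiv ℝ g) p a b =
      inner ℝ (fderiv ℝ (gradient g) p a) b := by
    intro a b
    have h1 : HasFDerivAt (fderiv ℝ g)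
        ((InnerProductSpace.toDual ℝ H).toContinuousLinearEquiv.toContinuousLinearMap ∘L
          fderiv ℝ (gradient g) p) p := by
      rw [← toDual_comp_gradient]
      exact (InnerProductSpace.toDual ℝ H).toContinuousLinearEquiv.hasFDerivAt.comp p
        hG.hasFDerivAt
    rw [h1.fderiv]
    simp
  rw [← h, ← h]
  exact (hg.contDiffAt.isSymmSndFDerivAt (by simp)).eq u w

lemma hasStrictFDerivAt_grady {g : WithLp 2 (E × F) → ℝ} (hg : ContDiff ℝ 2 g) (p : E × F) :
    HasStrictFDerivAt (fun p : E × F => grady g p.1 p.2)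
      (ContinuousLinearMap.snd ℝ E F ∘L pmkL.symm.toContinuousLinearMap ∘L
        fderiv ℝ (gradient g) (pmkL p) ∘L pmkL.toContinuousLinearMap) p :=
  (ContinuousLinearMap.snd ℝ E F ∘L pmkL.symm.toContinuousLinearMap).hasStrictFDerivAt.comp p
    (((contDiff_gradient hg).contDiffAt.hasStrictFDerivAt one_ne_zero).comp p
      (pmkL (E := E) (F := F)).hasStrictFDerivAt)

lemma hasFDerivAt_pmk_right (x : E) (y : F) :
    HasFDerivAt (fun y : F => pmk x y)
      (pmkL.toContinuousLinearMap ∘L ContinuousLinearMap.inr ℝ E F) y :=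
  (pmkL (E := E) (F := F)).hasFDerivAt.comp y (hasFDerivAt_prodMk_right x y)

lemma hessyy_eq {g : WithLp 2 (E × F) → ℝ} (hg : ContDiff ℝ 2 g) (x : E) (y : F) :
    hessyy g x y = (ContinuousLinearMap.snd ℝ E F ∘L pmkL.symm.toContinuousLinearMap ∘L
      fderiv ℝ (gradient g) (pmk x y) ∘L pmkL.toContinuousLinearMap) ∘L
        ContinuousLinearMap.inr ℝ E F :=
  HasFDerivAt.fderiv <|
    (hasStrictFDerivAt_grady hg (x, y)).hasFDerivAt.comp y (hasFDerivAt_prodMk_right x y)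

lemma hessxy_eq {g : WithLp 2 (E × F) → ℝ} (hg : ContDiff ℝ 2 g) (x : E) (y : F) :
    hessxy g x y = (ContinuousLinearMap.fst ℝ E F ∘L pmkL.symm.toContinuousLinearMap) ∘L
      fderiv ℝ (gradient g) (pmk x y) ∘L
        (pmkL.toContinuousLinearMap ∘L ContinuousLinearMap.inr ℝ E F) :=
  HasFDerivAt.fderiv <|
    (ContinuousLinearMap.fst ℝ E F ∘L pmkL.symm.toContinuousLinearMap).hasFDerivAt.comp y
      (((contDiff_gradient hg).differentiable one_ne_zero _).hasFDerivAt.comp y (hasFDerivAt_pmk_right x y))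

lemma inner_hessyy_comm {g : WithLp 2 (E × F) → ℝ} (hg : ContDiff ℝ 2 g) (x : E) (y v w : F) :
    inner ℝ (hessyy g x y v) w = inner ℝ (hessyy g x y w) v := by
  have h := inner_fderiv_gradient_comm hg (pmk x y) (pmk 0 v) (pmk 0 w)
  simp only [inner_pmk, inner_zero_right, zero_add] at h
  rw [hessyy_eq hg]
  exact h

lemma inner_hessxy {g : WithLp 2 (E × F) → ℝ} (hg : ContDiff ℝ 2 g) (x u : E) (y w : F) :
    inner ℝ (hessxy g x y w) u =
      inner ℝ (pmkL.symm (fderiv ℝ (gradient g) (pmk x y) (pmk u 0))).2 w := by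
  have h := inner_fderiv_gradient_comm hg (pmk x y) (pmk 0 w) (pmk u 0)
  simp only [inner_pmk, inner_zero_right, zero_add, add_zero] at h
  rw [hessxy_eq hg]
  exact h

lemma hasDerivAt_line {g : WithLp 2 (E × F) → ℝ} (hg : Differentiable ℝ g) (x : E) (y v : F)
    (t : ℝ) :
    HasDerivAt (fun t : ℝ => g (pmk x (y + t • v))) (inner ℝ (grady g x (y + t • v)) v) t := by
  have hl : HasDerivAt (fun t : ℝ => y + t • v) v t := by
    simpa using ((hasDerivAt_id t).smul_const v).const_add y
  have h := (hg (pmk x (y + t • v))).hasGradientAt.hasFDerivAt.comp_hasDerivAt t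
    ((hasFDerivAt_pmk_right x (y + t • v)).comp_hasDerivAt t hl)
  refine h.congr_deriv ?_
  have := inner_pmk (gradient g (pmk x (y + t • v))) (0 : E) v
  simp only [inner_zero_right, zero_add] at this
  exact this

/-- The gradient of a strongly convex function is strongly monotone along lines. -/
lemma monotone_inner_grady {g : WithLp 2 (E × F) → ℝ} (hg : Differentiable ℝ g) {μ : ℝ} {x : E}
    (hsc : ConvexOn ℝ Set.univ (fun y : F => g (pmk x y) - μ / 2 * ‖y‖ ^ 2)) (y v : F) :
    Monotone fun t : ℝ => inner ℝ (grady g x (y + t • v)) v - t * (μ * ‖v‖ ^ 2) := by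
  have hd : ∀ t : ℝ, HasDerivAt (fun t : ℝ => g (pmk x (y + t • v)) - μ / 2 * ‖y + t • v‖ ^ 2)
      (inner ℝ (grady g x (y + t • v)) v - μ * inner ℝ (y + t • v) v) t := by
    intro t
    have hl : HasDerivAt (fun t : ℝ => y + t • v) v t := by
      simpa using ((hasDerivAt_id t).smul_const v).const_add y
    refine ((hasDerivAt_line hg x y v t).sub (hl.norm_sq.const_mul (μ / 2))).congr_deriv ?_
    ring
  have hc : ConvexOn ℝ Set.univ
      (fun t : ℝ => g (pmk x (y + t • v)) - μ / 2 * ‖y + t • v‖ ^ 2) := by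
    have := hsc.comp_affineMap (AffineMap.lineMap y (y + v) : ℝ →ᵃ[ℝ] F)
    simpa [Function.comp_def, AffineMap.lineMap_apply, add_comm] using this
  have hm := hc.monotoneOn_deriv fun t _ => (hd t).differentiableAt
  intro s t hst
  have h := hm (Set.mem_univ s) (Set.mem_univ t) hst
  rw [(hd s).deriv, (hd t).deriv] at h
  simp only [inner_add_left, real_inner_smul_left, real_inner_self_eq_norm_sq] at h
  simp only
  linarith

lemma eq_of_grady_eq_zero {g : WithLp 2 (E × F) → ℝ} (hg : Differentiable ℝ g) {μ : ℝ}
    (hμ : 0 < μ) {x : E}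
    (hsc : ConvexOn ℝ Set.univ (fun y : F => g (pmk x y) - μ / 2 * ‖y‖ ^ 2)) {y z : F}
    (hy : grady g x y = 0) (hz : grady g x z = 0) : y = z := by
  have h := monotone_inner_grady hg hsc y (z - y) zero_le_one
  simp only [zero_smul, add_zero, one_smul, add_sub_cancel, hy, hz, inner_zero_left] at h
  have h0 : ‖z - y‖ ^ 2 ≤ 0 := by
    by_contra! hpos
    nlinarith [mul_pos hμ hpos]
  have : z - y = 0 := by
    rw [← norm_eq_zero]
    exact pow_eq_zero_iff two_ne_zero |>.1 (le_antisymm h0 (sq_nonneg _))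
  exact (sub_eq_zero.1 this).symm

lemma grady_eq_zero_of_forall_le {g : WithLp 2 (E × F) → ℝ} (hg : Differentiable ℝ g) {x : E}
    {y : F} (h : ∀ z, g (pmk x y) ≤ g (pmk x z)) : grady g x y = 0 := by
  have hd := hasDerivAt_line hg x y (grady g x y) 0
  simp only [zero_smul, add_zero] at hd
  refine inner_self_eq_zero.1 (IsLocalMin.hasDerivAt_eq_zero (Filter.Eventually.of_forall ?_) hd)
  intro t
  simpa using h _

lemma le_inner_hessyy {g : WithLp 2 (E × F) → ℝ} (hg : ContDiff ℝ 2 g) {μ : ℝ} {x : E}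
    (hsc : ConvexOn ℝ Set.univ (fun y : F => g (pmk x y) - μ / 2 * ‖y‖ ^ 2)) (y v : F) :
    μ * ‖v‖ ^ 2 ≤ inner ℝ (hessyy g x y v) v := by
  have hA : HasFDerivAt (fun y => grady g x y) (hessyy g x y) (y + (0 : ℝ) • v) := by
    rw [zero_smul, add_zero]
    exact ((hasStrictFDerivAt_grady hg (x, y)).hasFDerivAt.comp y
      (hasFDerivAt_prodMk_right x y)).differentiableAt.hasFDerivAt
  have hl : HasDerivAt (fun t : ℝ => y + t • v) v 0 := by
    simpa using ((hasDerivAt_id (0 : ℝ)).smul_const v).const_add y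
  have hd := ((hA.comp_hasDerivAt (0 : ℝ) hl).inner ℝ (hasDerivAt_const (0 : ℝ) v)).sub
    ((hasDerivAt_id (0 : ℝ)).mul_const (μ * ‖v‖ ^ 2))
  have h := (monotone_inner_grady (hg.differentiable two_ne_zero) hsc y v).deriv_nonneg (x := 0)
  have h' := hd.deriv
  simp only [Function.comp_def, inner_zero_right, zero_add, one_mul] at h'
  have h2 : deriv (fun t : ℝ => inner ℝ (grady g x (y + t • v)) v - t * (μ * ‖v‖ ^ 2)) 0 =
    inner ℝ (hessyy g x y v) v - μ * ‖v‖ ^ 2 := h'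
  linarith

lemma isInvertible_hessyy {g : WithLp 2 (E × F) → ℝ} (hg : ContDiff ℝ 2 g) {μ : ℝ} (hμ : 0 < μ)
    {x : E} (hsc : ConvexOn ℝ Set.univ (fun y : F => g (pmk x y) - μ / 2 * ‖y‖ ^ 2)) (y : F) :
    (hessyy g x y).IsInvertible := by
  have hinj : Function.Injective (hessyy g x y : F →ₗ[ℝ] F) := by
    rw [injective_iff_map_eq_zero]
    intro v hv
    have h := le_inner_hessyy hg hsc y v
    rw [show hessyy g x y v = 0 from hv, inner_zero_left] at h
    by_contra hne
    have : 0 < ‖v‖ := norm_pos_iff.2 hne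
    have := mul_pos hμ (pow_pos this 2)
    linarith
  exact ⟨(LinearEquiv.ofInjectiveEndo _ hinj).toContinuousLinearEquiv, by ext; simp⟩

/-- The derivative of the lower-level solution map, by the implicit function theorem. -/
lemma hasFDerivAt_minimizer {g : WithLp 2 (E × F) → ℝ} (hg : ContDiff ℝ 2 g) {μ : ℝ} (hμ : 0 < μ)
    (hsc : ∀ x : E, ConvexOn ℝ Set.univ (fun y : F => g (pmk x y) - μ / 2 * ‖y‖ ^ 2))
    {ystar : E → F} (hmin : ∀ x : E, ∀ y : F, g (pmk x (ystar x)) ≤ g (pmk x y)) (x : E) :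
    HasFDerivAt ystar
      (-(hessyy g x (ystar x)).inverse ∘L
        ((ContinuousLinearMap.snd ℝ E F ∘L pmkL.symm.toContinuousLinearMap ∘L
          fderiv ℝ (gradient g) (pmk x (ystar x)) ∘L pmkL.toContinuousLinearMap) ∘L
            ContinuousLinearMap.inl ℝ E F)) x := by
  have hd := hg.differentiable two_ne_zero
  have hcrit : ∀ x, grady g x (ystar x) = 0 := fun x => grady_eq_zero_of_forall_le hd (hmin x)
  have hG := hasStrictFDerivAt_grady hg (x, ystar x)
  have hinv := isInvertible_hessyy hg hμ (hsc x) (ystar x)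
  rw [hessyy_eq hg] at hinv ⊢
  refine (hG.hasStrictFDerivAt_implicitFunctionOfProdDomain hinv).hasFDerivAt.congr_of_eventuallyEq
    ?_
  filter_upwards [hG.eventually_apply_implicitFunctionOfProdDomain hinv] with x' hx'
  exact eq_of_grady_eq_zero hd hμ (hsc x') (hcrit x') (hx'.trans (hcrit x))

/-- **The hypergradient formula.**
If `g` is `C²` with `ℓ`-Lipschitz gradient, `μ`-strongly convex in `y` for every `x`
(`0 < μ ≤ ℓ`) with minimizer `y*(x)`, and `f` is `C¹`, then `Φ(x) = f(x, y*(x))` is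
differentiable everywhere with gradient
`∇Φ(x) = ∇_x f(x, y*(x)) − ∇²_{xy} g(x, y*(x)) [(∇²_{yy} g(x, y*(x)))⁻¹ ∇_y f(x, y*(x))]`. -/
theorem hypergradient_formula
    (g : WithLp 2 (E × F) → ℝ) (ℓ μ : ℝ) (hμ : 0 < μ) (hμℓ : μ ≤ ℓ)
    (hg : ContDiff ℝ 2 g)
    (hglip : LipschitzWith ℓ.toNNReal (gradient g))
    (hsc : ∀ x : E, ConvexOn ℝ Set.univ (fun y : F => g (pmk x y) - μ / 2 * ‖y‖ ^ 2))
    (ystar : E → F)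
    (hmin : ∀ x : E, ∀ y : F, g (pmk x (ystar x)) ≤ g (pmk x y))
    (f : WithLp 2 (E × F) → ℝ) (hf : ContDiff ℝ 1 f)
    (Φ : E → ℝ) (hΦ : ∀ x : E, Φ x = f (pmk x (ystar x))) :
    ∀ x : E, HasGradientAt Φ
      (gradx f x (ystar x) -
        hessxy g x (ystar x) ((hessyy g x (ystar x)).inverse (grady f x (ystar x)))) x := by
  intro x
  rw [hasGradientAt_iff_hasFDerivAt, funext hΦ]
  have hy := hasFDerivAt_minimizer hg hμ hsc hmin x
  have hinv := isInvertible_hessyy hg hμ (hsc x) (ystar x)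
  have hp := pmkL.hasFDerivAt.comp x ((hasFDerivAt_id x).prodMk hy)
  refine ((hf.differentiable one_ne_zero _).hasGradientAt.hasFDerivAt.comp x hp).congr_fderiv ?_
  ext u
  set B : F := (pmkL.symm (fderiv ℝ (gradient g) (pmk x (ystar x)) (pmk u 0))).2 with hB
  obtain ⟨e, he⟩ := hinv
  have hl := inner_pmk (gradient f (pmk x (ystar x))) u (-(hessyy g x (ystar x)).inverse B)
  have hsymm := inner_hessyy_comm hg x (ystar x)
    (e.symm (grady f x (ystar x))) (e.symm B)
  have hxy := inner_hessxy hg x u (ystar x) (e.symm (grady f x (ystar x)))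
  rw [← he, ContinuousLinearMap.inverse_equiv] at *
  simp only [ContinuousLinearEquiv.coe_coe, ContinuousLinearEquiv.apply_symm_apply] at hsymm hl hxy
  rw [InnerProductSpace.toDual_apply_apply, inner_sub_left]
  refine hl.trans ?_
  rw [inner_neg_right, ← sub_eq_add_neg]
  refine congrArg₂ _ rfl ?_
  exact hsymm.trans hxy.symm
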